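/- arXiv:1312.6745 — 2 statements merged into one kernel-verified Lean document; each statement's English description precedes it below -/
import Mathlib

section
/- (Absorbing set.) Let τ > 0, S¹ = ℝ/2τℤ with measure of total mass 2τ, J ∈ L^∞(S¹), h > 0, and assume f : ℝ → ℝ is globally Lipschitz and takes values in [0, S_max] for some S_max > 0. Set R = 2τ‖J‖_∞ S_max + h. Then every mild solution u of the neural field equation with initial datum u₀ ∈ L²(S¹) satisfies ‖u(t)‖_{L²} ≤ e^{−t}‖u₀‖_{L²} + R√(2τ) for all t ≥ 0; in particular, for every ε > 0, ‖u(t)‖_{L²} ≤ R√(2τ) + ε whenever t > ln(‖u₀‖_{L²}/ε), i.e. the ball of L²(S¹) centered at the origin of radius R√(2τ) + ε is absorbing. -/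
open MeasureTheory Real

/-- A mild solution of the neural field equation `∂u/∂t = -u + J*(f∘u) + h` in
`L²(S¹)` (with nonlinearity realized by the map `Φ`), with initial datum `u₀`. -/
def IsMildSolution {τ : ℝ} [Fact (0 < 2 * τ)]
    (Φ : Lp ℝ 2 (volume : Measure (AddCircle (2 * τ))) →
         Lp ℝ 2 (volume : Measure (AddCircle (2 * τ))))
    (u₀ : Lp ℝ 2 (volume : Measure (AddCircle (2 * τ))))
    (u : ℝ → Lp ℝ 2 (volume : Measure (AddCircle (2 * τ)))) : Prop :=
  ContinuousOn u (Set.Ici 0) ∧ u 0 = u₀ ∧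
    ∀ t ≥ (0 : ℝ), u t = Real.exp (-t) • u₀ +
      ∫ s in (0:ℝ)..t, Real.exp (-(t - s)) • Φ (u s)

/-- Absorbing set: every mild solution satisfies
`‖u(t)‖ ≤ e^{-t}‖u₀‖ + R√(2τ)` with `R = 2τ‖J‖_∞ S_max + h`; in particular the
ball of radius `R√(2τ) + ε` is reached after time `ln(‖u₀‖/ε)`. -/
theorem neural_field_absorbing_set (τ : ℝ) [Fact (0 < 2 * τ)]
    (J : AddCircle (2 * τ) → ℝ) (hJmeas : Measurable J)
    (Jnorm : ℝ) (hJnorm : ∀ z, |J z| ≤ Jnorm)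
    (h : ℝ) (hh : 0 < h)
    (f : ℝ → ℝ) (k₁ : ℝ) (hk₁ : 0 < k₁)
    (hf : ∀ x y : ℝ, |f x - f y| ≤ k₁ * |x - y|)
    (Smax : ℝ) (hSmax : 0 < Smax) (hfval : ∀ x, f x ∈ Set.Icc 0 Smax)
    (Φ : Lp ℝ 2 (volume : Measure (AddCircle (2 * τ))) →
         Lp ℝ 2 (volume : Measure (AddCircle (2 * τ))))
    (hΦ : ∀ u : Lp ℝ 2 (volume : Measure (AddCircle (2 * τ))),
      (Φ u : AddCircle (2 * τ) → ℝ) =ᵐ[volume]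
        fun w => (∫ z, J (w - z) * f (u z)) + h)
    (R : ℝ) (hR : R = 2 * τ * Jnorm * Smax + h)
    (u₀ : Lp ℝ 2 (volume : Measure (AddCircle (2 * τ))))
    (u : ℝ → Lp ℝ 2 (volume : Measure (AddCircle (2 * τ))))
    (hu : IsMildSolution Φ u₀ u) :
    (∀ t ≥ (0:ℝ), ‖u t‖ ≤ Real.exp (-t) * ‖u₀‖ + R * Real.sqrt (2 * τ)) ∧
    (∀ ε > (0:ℝ), ∀ t ≥ (0:ℝ), Real.log (‖u₀‖ / ε) < t →
      ‖u t‖ ≤ R * Real.sqrt (2 * τ) + ε) := by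
  have hT : (0:ℝ) < 2 * τ := Fact.out
  obtain ⟨-, -, hu⟩ := hu
  have hJ0 : 0 ≤ Jnorm := (abs_nonneg _).trans (hJnorm 0)
  have hR0 : 0 ≤ R := by rw [hR]; positivity
  have hvol : (volume : Measure (AddCircle (2 * τ))).real Set.univ = 2 * τ := by
    rw [Measure.real, AddCircle.measure_univ, ENNReal.toReal_ofReal hT.le]
  have hC : ∀ v, ‖Φ v‖ ≤ R * Real.sqrt (2 * τ) := by
    intro v
    have hb : ∀ᵐ w ∂(volume : Measure (AddCircle (2 * τ))), ‖Φ v w‖ ≤ R := by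
      filter_upwards [hΦ v] with w hw
      rw [hw]
      have h1 : ‖∫ z, J (w - z) * f (v z)‖ ≤
          (Jnorm * Smax) * (volume : Measure (AddCircle (2 * τ))).real Set.univ := by
        apply norm_integral_le_of_norm_le_const
        filter_upwards with z
        rw [norm_mul, Real.norm_eq_abs, Real.norm_eq_abs, abs_of_nonneg (hfval _).1]
        exact mul_le_mul (hJnorm _) (hfval _).2 (hfval _).1 hJ0
      rw [hvol] at h1
      refine (norm_add_le _ _).trans ?_
      rw [Real.norm_of_nonneg hh.le, hR]
      linarith
    have h2 := Lp.norm_le_of_ae_bound hR0 hb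
    have h3 : ((measureUnivNNReal (volume : Measure (AddCircle (2 * τ))) : NNReal) : ℝ) = 2 * τ :=
      hvol
    rw [h3] at h2
    refine h2.trans (le_of_eq ?_)
    rw [Real.sqrt_eq_rpow, mul_comm R, ENNReal.toReal_ofNat, one_div]
  have hC0 : 0 ≤ R * Real.sqrt (2 * τ) := by positivity
  have main : ∀ t ≥ (0:ℝ), ‖u t‖ ≤ Real.exp (-t) * ‖u₀‖ + R * Real.sqrt (2 * τ) := by
    intro t ht
    rw [hu t ht]
    refine (norm_add_le _ _).trans ?_
    rw [norm_smul, Real.norm_of_nonneg (Real.exp_pos _).le]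
    gcongr
    have h1 : ‖∫ s in (0:ℝ)..t, Real.exp (-(t - s)) • Φ (u s)‖ ≤
        ∫ s in (0:ℝ)..t, Real.exp (-(t - s)) * (R * Real.sqrt (2 * τ)) := by
      apply intervalIntegral.norm_integral_le_of_norm_le ht
      · filter_upwards with s hs
        rw [norm_smul, Real.norm_of_nonneg (Real.exp_pos _).le]
        gcongr
        exact hC _
      · apply Continuous.intervalIntegrable
        fun_prop
    refine h1.trans ?_
    have h2 : ∫ s in (0:ℝ)..t, Real.exp (-(t - s)) = 1 - Real.exp (-t) := by
      have := intervalIntegral.integral_eq_sub_of_hasDerivAt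
        (f := fun s => Real.exp (-(t - s))) (f' := fun s => Real.exp (-(t - s))) (a := 0) (b := t)
        (fun s _ => by
          have := (((hasDerivAt_id s).const_sub t).neg).exp
          simpa using this)
        (Continuous.intervalIntegrable (by fun_prop) _ _)
      simpa using this
    rw [intervalIntegral.integral_mul_const, h2]
    have := Real.exp_pos (-t)
    nlinarith
  refine ⟨main, fun ε hε t ht hlog => (main t ht).trans ?_⟩
  have h4 : Real.exp (-t) * ‖u₀‖ ≤ ε := by
    rcases (norm_nonneg u₀).eq_or_lt with h0 | h0
    · rw [← h0]; simpa using hε.le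
    · rw [Real.log_lt_iff_lt_exp (by positivity), div_lt_iff₀ hε] at hlog
      rw [Real.exp_neg, inv_mul_le_iff₀ (Real.exp_pos _)]
      exact hlog.le
  linarith
end

section
/- (Existence of a global attractor.) Let τ > 0, S¹ = ℝ/2τℤ with measure of total mass 2τ, J ∈ C(S¹), h > 0, and assume (H1) (f ∈ C¹, f′ locally Lipschitz, 0 < f′ < k₁) and (H2) (f nondecreasing with values in [0, S_max]). Let T(t)u₀ denote the value at time t of the unique mild solution with initial datum u₀. Then there exists a set 𝒜 ⊆ L²(S¹) which is compact, invariant (T(t)𝒜 = 𝒜 for all t ≥ 0), attracts bounded sets (for every bounded B ⊆ L²(S¹), sup_{u₀∈B} inf_{a∈𝒜} ‖T(t)u₀ − a‖_{L²} → 0 as t → ∞), and is contained in the closed ball of L²(S¹) centered at the origin of radius (2τ‖J‖_∞ S_max + h)√(2τ). -/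
open MeasureTheory Real

/-- `T` is the mild-solution semiflow of the neural field equation
`∂u/∂t = -u + J*(f∘u) + h`, with nonlinearity realized by the map `Φ`. -/
def IsMildSemiflow {τ : ℝ} [Fact (0 < 2 * τ)]
    (Φ : Lp ℝ 2 (volume : Measure (AddCircle (2 * τ))) →
         Lp ℝ 2 (volume : Measure (AddCircle (2 * τ))))
    (T : ℝ → Lp ℝ 2 (volume : Measure (AddCircle (2 * τ))) →
         Lp ℝ 2 (volume : Measure (AddCircle (2 * τ)))) : Prop :=
  ∀ u₀, ContinuousOn (fun t => T t u₀) (Set.Ici 0) ∧ T 0 u₀ = u₀ ∧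
    ∀ t ≥ (0 : ℝ), T t u₀ = Real.exp (-t) • u₀ +
      ∫ s in (0:ℝ)..t, Real.exp (-(t - s)) • Φ (T s u₀)


lemma nf_attr_metric {X : Type*} [MetricSpace X] (T : ℝ → X → X) (K : Set X)
    (hK : IsCompact K) (hcont : ∀ t ≥ (0:ℝ), Continuous (T t))
    (hsg : ∀ s ≥ (0:ℝ), ∀ t ≥ (0:ℝ), ∀ u, T (s + t) u = T s (T t u))
    (hinv : ∀ t ≥ (0:ℝ), ∀ u ∈ K, T t u ∈ K) :
    ∃ A ⊆ K, IsCompact A ∧ (∀ t ≥ (0:ℝ), T t '' A = A) ∧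
      ∀ ε > (0:ℝ), ∃ t ≥ (0:ℝ), ∀ u ∈ K, ∃ a ∈ A, dist (T t u) a < ε := by
  have hcomp : ∀ s : NNReal, IsCompact (T s '' K) := fun s => hK.image (hcont s s.2)
  have hanti : ∀ s t : NNReal, T ((s + t : NNReal) : ℝ) '' K ⊆ T s '' K := by
    rintro s t _ ⟨k, hk, rfl⟩
    refine ⟨T t k, hinv t t.2 k hk, ?_⟩
    rw [NNReal.coe_add, hsg s s.2 t t.2]
  have hdir : ∀ s t : NNReal, T ((s + t : NNReal) : ℝ) '' K ⊆ T t '' K := by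
    intro s t; rw [add_comm]; exact hanti t s
  refine ⟨⋂ s : NNReal, T s '' K, ?_, ?_, ?_, ?_⟩
  · refine (Set.iInter_subset _ 0).trans ?_
    rintro _ ⟨k, hk, rfl⟩
    exact hinv _ (0:NNReal).2 k hk
  · refine (hcomp 0).of_isClosed_subset (isClosed_iInter fun s => (hcomp s).isClosed)
      (Set.iInter_subset _ 0)
  · intro t ht
    apply Set.Subset.antisymm
    · rintro _ ⟨a, ha, rfl⟩
      refine Set.mem_iInter.2 fun s => ?_
      obtain ⟨k, hk, rfl⟩ := Set.mem_iInter.1 ha s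
      refine ⟨T t k, hinv t ht k hk, ?_⟩
      rw [← hsg s s.2 t ht, ← hsg t ht s s.2, add_comm]
    · intro a ha
      have key : (⋂ s : NNReal, (T s '' K ∩ T t ⁻¹' {a})).Nonempty := by
        have hcl : IsClosed (T t ⁻¹' {a}) := isClosed_singleton.preimage (hcont t ht)
        refine IsCompact.nonempty_iInter_of_directed_nonempty_isCompact_isClosed _ ?_ ?_ ?_ ?_
        · intro s r
          exact ⟨s + r, Set.inter_subset_inter_left _ (hanti s r),
            Set.inter_subset_inter_left _ (hdir s r)⟩
        · intro s
          obtain ⟨k, hk, hka⟩ := Set.mem_iInter.1 ha (⟨t, ht⟩ + s)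
          refine ⟨T s k, ⟨k, hk, rfl⟩, ?_⟩
          rw [Set.mem_preimage, ← hsg t ht s s.2]
          exact hka
        · intro s; exact (hcomp s).inter_right hcl
        · intro s; exact (hcomp s).isClosed.inter hcl
      obtain ⟨x, hx⟩ := key
      rw [Set.mem_iInter] at hx
      exact ⟨x, Set.mem_iInter.2 fun s => (hx s).1, (hx 0).2⟩
  · intro ε hε
    obtain ⟨s, hs⟩ := exists_subset_nhds_of_isCompact (V := fun s : NNReal => T s '' K)
      (fun s r => ⟨s + r, hanti s r, hdir s r⟩) hcomp
      (U := Metric.thickening ε (⋂ s : NNReal, T s '' K))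
      (fun x hx => Metric.isOpen_thickening.mem_nhds (Metric.self_subset_thickening hε _ hx))
    refine ⟨s, s.2, fun u hu => ?_⟩
    exact Metric.mem_thickening_iff.1 (hs ⟨u, hu, rfl⟩)

set_option linter.unusedSectionVars false

section
variable {X : Type*} [NormedAddCommGroup X] [NormedSpace ℝ X] [CompleteSpace X]

def NfMild (Φ : X → X) (T : ℝ → X → X) : Prop :=
  ∀ u₀, ContinuousOn (fun t => T t u₀) (Set.Ici 0) ∧ T 0 u₀ = u₀ ∧
    ∀ t ≥ (0 : ℝ), T t u₀ = Real.exp (-t) • u₀ +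
      ∫ s in (0:ℝ)..t, Real.exp (-(t - s)) • Φ (T s u₀)

lemma nf_formula {Φ : X → X} {T : ℝ → X → X} (hT : NfMild Φ T) (u : X) (t : ℝ) (ht : 0 ≤ t) :
    Real.exp t • T t u = u + ∫ s in (0:ℝ)..t, Real.exp s • Φ (T s u) := by
  rw [(hT u).2.2 t ht, smul_add, smul_smul, ← Real.exp_add, ← intervalIntegral.integral_smul]
  simp [smul_smul, ← Real.exp_add]

lemma nf_contOn {Φ : X → X} (hΦ : Continuous Φ) {T : ℝ → X → X} (hT : NfMild Φ T) (u : X) :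
    ContinuousOn (fun s => Real.exp s • Φ (T s u)) (Set.Ici 0) :=
  Real.continuous_exp.continuousOn.smul (hΦ.comp_continuousOn (hT u).1)

lemma nf_deriv {Φ : X → X} (hΦ : Continuous Φ) {T : ℝ → X → X} (hT : NfMild Φ T) (u : X)
    (t : ℝ) (ht : 0 ≤ t) :
    HasDerivWithinAt (fun s => Real.exp s • T s u) (Real.exp t • Φ (T t u)) (Set.Ici t) t := by
  have hc := nf_contOn hΦ hT u
  have h1 : HasDerivWithinAt (fun r => ∫ s in (0:ℝ)..r, Real.exp s • Φ (T s u))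
      (Real.exp t • Φ (T t u)) (Set.Ici t) t := by
    apply intervalIntegral.integral_hasDerivWithinAt_right
    · apply ContinuousOn.intervalIntegrable
      rw [Set.uIcc_of_le ht]
      exact hc.mono Set.Icc_subset_Ici_self
    · exact (hc.mono (fun x hx => ht.trans (le_of_lt hx))).stronglyMeasurableAtFilter_nhdsWithin
        measurableSet_Ioi t
    · exact (hc t ht).mono (fun x hx => ht.trans (le_of_lt hx))
  have h2 := h1.const_add u
  refine h2.congr_of_mem (fun x hx => ?_) Set.self_mem_Ici
  exact nf_formula hT u x (ht.trans hx)

lemma nf_gronwall {Φ : X → X} {L : NNReal} (hL : LipschitzWith L Φ) (y z : ℝ → X)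
    (hyc : ContinuousOn y (Set.Ici 0)) (hzc : ContinuousOn z (Set.Ici 0))
    (hy : ∀ t ≥ (0:ℝ), HasDerivWithinAt (fun s => Real.exp s • y s) (Real.exp t • Φ (y t))
      (Set.Ici t) t)
    (hz : ∀ t ≥ (0:ℝ), HasDerivWithinAt (fun s => Real.exp s • z s) (Real.exp t • Φ (z t))
      (Set.Ici t) t) (t : ℝ) (ht : 0 ≤ t) :
    dist (y t) (z t) ≤ dist (y 0) (z 0) * Real.exp (L * t) := by
  have hlip : ∀ t : ℝ, LipschitzWith L (fun x => Real.exp t • Φ (Real.exp (-t) • x)) := by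
    intro t
    refine LipschitzWith.of_dist_le_mul fun a b => ?_
    rw [dist_smul₀]
    have := hL.dist_le_mul (Real.exp (-t) • a) (Real.exp (-t) • b)
    rw [dist_smul₀] at this
    calc ‖Real.exp t‖ * dist (Φ (Real.exp (-t) • a)) (Φ (Real.exp (-t) • b))
        ≤ ‖Real.exp t‖ * (L * (‖Real.exp (-t)‖ * dist a b)) := by gcongr
      _ = L * dist a b := by
        rw [Real.norm_of_nonneg (Real.exp_nonneg _), Real.norm_of_nonneg (Real.exp_nonneg _),
          Real.exp_neg]
        field_simp
  have hb : ∀ (w : ℝ → X) (s : ℝ), Real.exp (-s) • Real.exp s • w s = w s := by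
    intro w s; rw [smul_smul, ← Real.exp_add]; simp
  have := dist_le_of_trajectories_ODE (v := fun t x => Real.exp t • Φ (Real.exp (-t) • x))
    (K := L) (f := fun s => Real.exp s • y s) (g := fun s => Real.exp s • z s) (a := 0) (b := t)
    (δ := dist (y 0) (z 0)) hlip
    ((Real.continuous_exp.continuousOn.smul hyc).mono Set.Icc_subset_Ici_self)
    (fun s hs => by simpa only [hb] using hy s hs.1)
    ((Real.continuous_exp.continuousOn.smul hzc).mono Set.Icc_subset_Ici_self)
    (fun s hs => by simpa only [hb] using hz s hs.1) (by simp) t ⟨ht, le_rfl⟩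
  simp only [dist_smul₀, sub_zero] at this
  refine le_trans ?_ this
  rw [Real.norm_of_nonneg (Real.exp_nonneg _)]
  exact le_mul_of_one_le_left dist_nonneg (Real.one_le_exp ht)

lemma nf_lip {Φ : X → X} {L : NNReal} (hL : LipschitzWith L Φ) {T : ℝ → X → X}
    (hT : NfMild Φ T) (t : ℝ) (ht : 0 ≤ t) (u v : X) :
    dist (T t u) (T t v) ≤ dist u v * Real.exp (L * t) := by
  have := nf_gronwall hL (fun s => T s u) (fun s => T s v) (hT u).1 (hT v).1
    (nf_deriv hL.continuous hT u) (nf_deriv hL.continuous hT v) t ht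
  simpa only [(hT u).2.1, (hT v).2.1] using this

lemma nf_semigroup {Φ : X → X} {L : NNReal} (hL : LipschitzWith L Φ) {T : ℝ → X → X}
    (hT : NfMild Φ T) (s : ℝ) (hs : 0 ≤ s) (t : ℝ) (ht : 0 ≤ t) (u : X) :
    T (s + t) u = T s (T t u) := by
  have := nf_gronwall hL (fun r => T (r + t) u) (fun r => T r (T t u))
    ((hT u).1.comp (by fun_prop) (fun r (hr : 0 ≤ r) => add_nonneg hr ht)) (hT _).1
    (fun r hr => by
      have h1 := nf_deriv hL.continuous hT u (r + t) (add_nonneg hr ht)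
      have h2 : HasDerivWithinAt (fun r : ℝ => r + t) 1 (Set.Ici r) r :=
        (hasDerivWithinAt_id r _).add_const t
      have h3 := (h1.scomp r h2 (fun x (hx : r ≤ x) => by simpa using hx)).const_smul
        (Real.exp (-t))
      convert h3 using 1
      · funext x
        simp only [Function.comp, Pi.smul_apply, smul_smul, ← Real.exp_add]
        congr 2; ring
      · rw [one_smul, smul_smul, ← Real.exp_add]
        congr 2; ring)
    (nf_deriv hL.continuous hT (T t u)) s hs
  simp only [zero_add, (hT (T t u)).2.1, dist_self, zero_mul] at this
  exact dist_le_zero.1 this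

lemma nf_convex {Φ : X → X} (hΦ : Continuous Φ) {T : ℝ → X → X} (hT : NfMild Φ T)
    {K : Set X} (hKc : Convex ℝ K) (hKcl : IsClosed K) (hK : ∀ u, Φ u ∈ K)
    (u : X) (t : ℝ) (ht : 0 ≤ t) :
    ∃ k ∈ K, T t u = Real.exp (-t) • u + (1 - Real.exp (-t)) • k := by
  rcases ht.eq_or_lt with rfl | htpos
  · exact ⟨Φ u, hK u, by simp [(hT u).2.1]⟩
  have hpos : 0 < Real.exp t - 1 := by
    have := Real.add_one_lt_exp htpos.ne'; linarith
  have hint : IntervalIntegrable (fun s => Real.exp s • Φ (T s u)) volume 0 t := by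
    apply ContinuousOn.intervalIntegrable
    rw [Set.uIcc_of_le ht]
    exact (nf_contOn hΦ hT u).mono Set.Icc_subset_Ici_self
  set I := ∫ s in (0:ℝ)..t, Real.exp s • Φ (T s u) with hI
  refine ⟨(Real.exp t - 1)⁻¹ • I, ?_, ?_⟩
  · by_contra hn
    obtain ⟨φ, c, h1, h2⟩ := geometric_hahn_banach_closed_point hKc hKcl hn
    have h3 : φ I = ∫ s in (0:ℝ)..t, Real.exp s * φ (Φ (T s u)) := by
      rw [hI, ← φ.intervalIntegral_comp_comm hint]
      simp
    have h4 : φ I ≤ ∫ s in (0:ℝ)..t, Real.exp s * c := by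
      rw [h3]
      apply intervalIntegral.integral_mono_on ht
      · apply ContinuousOn.intervalIntegrable
        rw [Set.uIcc_of_le ht]
        exact Real.continuous_exp.continuousOn.mul (φ.continuous.comp_continuousOn
          (hΦ.comp_continuousOn ((hT u).1.mono Set.Icc_subset_Ici_self)))
      · exact (by fun_prop : Continuous fun s => Real.exp s * c).intervalIntegrable _ _
      · intro s hs
        exact mul_le_mul_of_nonneg_left (h1 _ (hK _)).le (Real.exp_nonneg _)
    rw [intervalIntegral.integral_mul_const, integral_exp, Real.exp_zero] at h4
    rw [map_smul, smul_eq_mul, inv_mul_eq_div, lt_div_iff₀ hpos] at h2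
    linarith
  · have h5 := nf_formula hT u t ht
    rw [← hI] at h5
    have h6 : T t u = Real.exp (-t) • (u + I) := by
      rw [← h5, smul_smul, ← Real.exp_add]; simp
    rw [h6, smul_add, smul_smul]
    congr 2
    rw [Real.exp_neg]
    field_simp

lemma nf_abstract {Φ : X → X} {L : NNReal} (hL : LipschitzWith L Φ) {T : ℝ → X → X}
    (hT : NfMild Φ T) (C : Set X) (hC : IsCompact C) (hΦC : ∀ u, Φ u ∈ C)
    (R : ℝ) (hR : ∀ u, ‖Φ u‖ ≤ R) :
    ∃ A : Set X,
      IsCompact A ∧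
      (∀ t ≥ (0:ℝ), T t '' A = A) ∧
      (∀ B : Set X,
        Bornology.IsBounded B → ∀ ε > (0:ℝ), ∃ t₀ : ℝ, ∀ t ≥ t₀, ∀ u₀ ∈ B,
          ∃ a ∈ A, ‖T t u₀ - a‖ < ε) ∧
      A ⊆ Metric.closedBall 0 R := by
  set K : Set X := closure (convexHull ℝ (Set.range Φ)) with hKdef
  have hKconv : Convex ℝ K := (convex_convexHull ℝ _).closure
  have hKcl : IsClosed K := isClosed_closure
  have hKcomp : IsCompact K := by
    refine TotallyBounded.isCompact_of_isClosed ?_ hKcl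
    exact ((hC.totallyBounded.subset (Set.range_subset_iff.2 hΦC)).convexHull).closure
  have hKΦ : ∀ u, Φ u ∈ K := fun u => subset_closure (subset_convexHull ℝ _ ⟨u, rfl⟩)
  have hKR : K ⊆ Metric.closedBall 0 R := by
    refine closure_minimal (convexHull_min ?_ (convex_closedBall 0 R)) Metric.isClosed_closedBall
    rintro _ ⟨u, rfl⟩
    simpa using hR u
  have hcv := nf_convex hL.continuous hT hKconv hKcl hKΦ
  obtain ⟨A, hAK, hAc, hAi, hAa⟩ := nf_attr_metric T K hKcomp
    (fun t ht => (LipschitzWith.of_dist_le_mul (K := ⟨Real.exp (L * t), Real.exp_nonneg _⟩)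
      (fun u v => by rw [mul_comm]; exact nf_lip hL hT t ht u v)).continuous)
    (fun s hs t ht u => nf_semigroup hL hT s hs t ht u)
    (fun t ht u hu => by
      obtain ⟨k, hk, hk'⟩ := hcv u t ht
      rw [hk']
      exact hKconv hu hk (Real.exp_nonneg _) (by simpa using ht) (by ring))
  refine ⟨A, hAc, hAi, ?_, hAK.trans hKR⟩
  intro B hB ε hε
  obtain ⟨M, hM⟩ := hB.exists_norm_le
  obtain ⟨t, ht, hta⟩ := hAa (ε / 2) (by positivity)
  have hlim : Filter.Tendsto (fun s : ℝ => Real.exp (-s) * (M + R) * Real.exp (L * t))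
      Filter.atTop (nhds 0) := by
    have := (Real.tendsto_exp_neg_atTop_nhds_zero.mul_const (M + R)).mul_const (Real.exp (L * t))
    simpa using this
  obtain ⟨s₀, hs₀⟩ := Filter.eventually_atTop.1 (hlim.eventually_lt_const (half_pos hε))
  refine ⟨t + max s₀ 0, fun r hr u hu => ?_⟩
  have hs1 : s₀ ≤ r - t := by have := le_max_left s₀ 0; linarith
  have hs2 : 0 ≤ r - t := by have := le_max_right s₀ 0; linarith
  obtain ⟨k, hk, hk'⟩ := hcv u (r - t) hs2
  obtain ⟨a, ha, hka⟩ := hta k hk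
  refine ⟨a, ha, ?_⟩
  rw [← dist_eq_norm]
  have e1 : T r u = T t (T (r - t) u) := by
    rw [← nf_semigroup hL hT t ht _ hs2]; congr 1; ring
  have e2 : dist (T (r - t) u) k ≤ Real.exp (-(r - t)) * (M + R) := by
    rw [dist_eq_norm, hk']
    have : Real.exp (-(r - t)) • u + (1 - Real.exp (-(r - t))) • k - k
        = Real.exp (-(r - t)) • (u - k) := by module
    rw [this, norm_smul, Real.norm_of_nonneg (Real.exp_nonneg _)]
    have hk2 : ‖k‖ ≤ R := by simpa using hKR hk
    gcongr
    exact (norm_sub_le _ _).trans (add_le_add (hM u hu) hk2)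
  have e3 := nf_lip hL hT t ht (T (r - t) u) k
  have e4 := hs₀ (r - t) hs1
  have e5 : dist (T (r - t) u) k * Real.exp (L * t)
      ≤ Real.exp (-(r - t)) * (M + R) * Real.exp (L * t) := by gcongr
  rw [e1]
  have := dist_triangle (T t (T (r - t) u)) (T t k) a
  linarith
end

section
variable {τ : ℝ} [Fact (0 < 2 * τ)]

lemma nf_Fmeas {f : ℝ → ℝ} (hf : Continuous f)
    (u : Lp ℝ 2 (volume : Measure (AddCircle (2 * τ)))) :
    AEStronglyMeasurable (fun z => f (u z)) volume :=
  hf.comp_aestronglyMeasurable (Lp.aestronglyMeasurable u)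

lemma nf_JFint {f : ℝ → ℝ} (hf : Continuous f) {Smax : ℝ} (hfval : ∀ x, f x ∈ Set.Icc 0 Smax)
    {J : AddCircle (2 * τ) → ℝ} (hJ : Continuous J) {Jnorm : ℝ} (hJnorm : ∀ z, |J z| ≤ Jnorm)
    (u : Lp ℝ 2 (volume : Measure (AddCircle (2 * τ)))) (w : AddCircle (2 * τ)) :
    Integrable (fun z => J (w - z) * f (u z)) volume := by
  refine Integrable.of_bound (C := Jnorm * Smax) ?_ ?_
  · exact (by fun_prop : Continuous fun z => J (w - z)).aestronglyMeasurable.mul (nf_Fmeas hf u)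
  · refine Filter.Eventually.of_forall fun z => ?_
    rw [norm_mul]
    refine mul_le_mul (hJnorm _) ?_ (norm_nonneg _) ((abs_nonneg _).trans (hJnorm 0))
    rw [Real.norm_of_nonneg (hfval _).1]
    exact (hfval _).2

lemma nf_mass : (volume : Measure (AddCircle (2 * τ))).real Set.univ = 2 * τ := by
  rw [Measure.real, AddCircle.measure_univ, ENNReal.toReal_ofReal]
  exact (Fact.out : 0 < 2 * τ).le

lemma nf_mass' : ((measureUnivNNReal (volume : Measure (AddCircle (2 * τ)))
    ^ (ENNReal.toReal 2)⁻¹ : NNReal) : ℝ) = Real.sqrt (2 * τ) := by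
  have : ((measureUnivNNReal (volume : Measure (AddCircle (2 * τ))) : NNReal) : ℝ) = 2 * τ :=
    nf_mass
  rw [NNReal.coe_rpow, this, Real.sqrt_eq_rpow]
  norm_num

lemma nf_L1 (d : Lp ℝ 2 (volume : Measure (AddCircle (2 * τ)))) :
    ∫ z, |d z| ≤ ‖d‖ * Real.sqrt (2 * τ) := by
  have h1 := eLpNorm_le_eLpNorm_mul_rpow_measure_univ (p := 1) (q := 2) (by norm_num)
    (Lp.aestronglyMeasurable d)
  have hi : Integrable d volume := (Lp.memLp d).integrable (by norm_num)
  have h2 : ∫ z, |d z| = (eLpNorm d 1 volume).toReal := by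
    rw [eLpNorm_one_eq_lintegral_enorm, ← integral_norm_eq_lintegral_enorm hi.1]
    rfl
  rw [h2, Lp.norm_def]
  have hne : (volume (Set.univ : Set (AddCircle (2 * τ)))) ^
      (1 / (1:ENNReal).toReal - 1 / (2:ENNReal).toReal) ≠ ⊤ :=
    ENNReal.rpow_ne_top_of_nonneg (by norm_num) (measure_ne_top _ _)
  refine (ENNReal.toReal_mono (ENNReal.mul_ne_top (Lp.eLpNorm_ne_top d) hne) h1).trans ?_
  rw [ENNReal.toReal_mul, ← ENNReal.toReal_rpow]
  have : (volume (Set.univ : Set (AddCircle (2 * τ)))).toReal = 2 * τ := nf_mass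
  rw [this, Real.sqrt_eq_rpow]
  norm_num

lemma nf_cont {f : ℝ → ℝ} (hf : Continuous f) {Smax : ℝ} (hfval : ∀ x, f x ∈ Set.Icc 0 Smax)
    {J : AddCircle (2 * τ) → ℝ} (hJ : Continuous J) {Jnorm : ℝ} (hJnorm : ∀ z, |J z| ≤ Jnorm)
    (hSmax : 0 < Smax) (h : ℝ) (ε : ℝ) (hε : 0 < ε) :
    ∃ δ > 0, ∀ (u : Lp ℝ 2 (volume : Measure (AddCircle (2 * τ)))) (w w' : AddCircle (2 * τ)),
      dist w w' < δ → dist ((∫ z, J (w - z) * f (u z)) + h) ((∫ z, J (w' - z) * f (u z)) + h)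
        < ε := by
  have hτ : 0 < 2 * τ := Fact.out
  have huc := CompactSpace.uniformContinuous_of_continuous hJ
  obtain ⟨δ, hδ, hd⟩ := Metric.uniformContinuous_iff.1 huc (ε / (2 * (Smax * (2 * τ))))
    (by positivity)
  refine ⟨δ, hδ, fun u w w' hw => ?_⟩
  rw [dist_add_right, dist_eq_norm, ← integral_sub (nf_JFint hf hfval hJ hJnorm u w)
    (nf_JFint hf hfval hJ hJnorm u w')]
  refine lt_of_le_of_lt (norm_integral_le_of_norm_le_const
    (C := ε / (2 * (Smax * (2 * τ))) * Smax) (Filter.Eventually.of_forall fun z => ?_)) ?_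
  · rw [← sub_mul, norm_mul]
    have h1 : dist (w - z) (w' - z) < δ := by rwa [dist_sub_right]
    have h2 := (hd h1).le
    rw [dist_eq_norm] at h2
    refine mul_le_mul h2 ?_ (norm_nonneg _) (by positivity)
    rw [Real.norm_of_nonneg (hfval _).1]
    exact (hfval _).2
  · rw [nf_mass]
    have : ε / (2 * (Smax * (2 * τ))) * Smax * (2 * τ) = ε / 2 := by
      have : τ ≠ 0 := by rintro rfl; simp at hτ
      field_simp
    rw [this]; linarith

lemma nf_bound {f : ℝ → ℝ} {Smax : ℝ} (hfval : ∀ x, f x ∈ Set.Icc 0 Smax)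
    {J : AddCircle (2 * τ) → ℝ} {Jnorm : ℝ} (hJnorm : ∀ z, |J z| ≤ Jnorm)
    (h : ℝ) (hh : 0 < h)
    (u : Lp ℝ 2 (volume : Measure (AddCircle (2 * τ)))) (w : AddCircle (2 * τ)) :
    ‖(∫ z, J (w - z) * f (u z)) + h‖ ≤ 2 * τ * Jnorm * Smax + h := by
  refine (norm_add_le _ _).trans ?_
  rw [Real.norm_of_nonneg hh.le]
  gcongr
  have := norm_integral_le_of_norm_le_const (μ := (volume : Measure (AddCircle (2 * τ))))
    (f := fun z => J (w - z) * f (u z))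
    (C := Jnorm * Smax) (Filter.Eventually.of_forall fun z => by
      rw [norm_mul]
      refine mul_le_mul (hJnorm _) ?_ (norm_nonneg _) ((abs_nonneg _).trans (hJnorm 0))
      rw [Real.norm_of_nonneg (hfval _).1]
      exact (hfval _).2)
  rw [nf_mass] at this
  linarith

end

/-- Existence of a global attractor for the neural field equation, contained in
the ball of radius `(2τ‖J‖_∞ S_max + h)√(2τ)`. -/
theorem neural_field_global_attractor (τ : ℝ) [Fact (0 < 2 * τ)]
    (J : AddCircle (2 * τ) → ℝ) (hJ : Continuous J)
    (Jnorm : ℝ) (hJnorm : ∀ z, |J z| ≤ Jnorm)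
    (h : ℝ) (hh : 0 < h)
    (f : ℝ → ℝ) (k₁ : ℝ) (hk₁ : 0 < k₁)
    -- (H1)
    (hf1 : ContDiff ℝ 1 f) (hf1' : LocallyLipschitz (deriv f))
    (hf1'' : ∀ r : ℝ, 0 < deriv f r ∧ deriv f r < k₁)
    -- (H2)
    (Smax : ℝ) (hSmax : 0 < Smax) (hf2 : Monotone f)
    (hfval : ∀ x, f x ∈ Set.Icc 0 Smax)
    (Φ : Lp ℝ 2 (volume : Measure (AddCircle (2 * τ))) →
         Lp ℝ 2 (volume : Measure (AddCircle (2 * τ))))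
    (hΦ : ∀ u : Lp ℝ 2 (volume : Measure (AddCircle (2 * τ))),
      (Φ u : AddCircle (2 * τ) → ℝ) =ᵐ[volume]
        fun w => (∫ z, J (w - z) * f (u z)) + h)
    (T : ℝ → Lp ℝ 2 (volume : Measure (AddCircle (2 * τ))) →
         Lp ℝ 2 (volume : Measure (AddCircle (2 * τ))))
    (hT : IsMildSemiflow Φ T) :
    ∃ A : Set (Lp ℝ 2 (volume : Measure (AddCircle (2 * τ)))),
      IsCompact A ∧
      (∀ t ≥ (0:ℝ), T t '' A = A) ∧
      (∀ B : Set (Lp ℝ 2 (volume : Measure (AddCircle (2 * τ)))),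
        Bornology.IsBounded B → ∀ ε > (0:ℝ), ∃ t₀ : ℝ, ∀ t ≥ t₀, ∀ u₀ ∈ B,
          ∃ a ∈ A, ‖T t u₀ - a‖ < ε) ∧
      A ⊆ Metric.closedBall 0 ((2 * τ * Jnorm * Smax + h) * Real.sqrt (2 * τ)) := by
  have hτ : 0 < 2 * τ := Fact.out
  have hJ0 : 0 ≤ Jnorm := (abs_nonneg _).trans (hJnorm 0)
  have hfc : Continuous f := hf1.continuous
  have hflip : ∀ a b, |f a - f b| ≤ k₁ * |a - b| := by
    intro a b
    have := Convex.norm_image_sub_le_of_norm_deriv_le (f := f) (s := Set.univ) (C := k₁)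
      (x := b) (y := a)
      (fun x _ => (hf1.differentiable (by norm_num)) x)
      (fun x _ => by rw [Real.norm_of_nonneg (hf1'' x).1.le]; exact (hf1'' x).2.le)
      convex_univ trivial trivial
    simpa using this
  -- Lipschitz bound
  have hLip : LipschitzWith (Real.toNNReal (Real.sqrt (2 * τ) * (Jnorm * k₁ * Real.sqrt (2 * τ))))
      Φ := by
    refine LipschitzWith.of_dist_le_mul fun u v => ?_
    rw [Real.coe_toNNReal _ (by positivity), dist_eq_norm, dist_eq_norm]
    have hb : ∀ᵐ w ∂(volume : Measure (AddCircle (2 * τ))),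
        ‖(Φ u - Φ v : Lp ℝ 2 (volume : Measure (AddCircle (2 * τ)))) w‖
          ≤ Jnorm * k₁ * (‖u - v‖ * Real.sqrt (2 * τ)) := by
      filter_upwards [hΦ u, hΦ v, Lp.coeFn_sub (Φ u) (Φ v)] with w h1 h2 h3
      rw [h3, Pi.sub_apply, h1, h2, add_sub_add_right_eq_sub,
        ← integral_sub (nf_JFint hfc hfval hJ hJnorm u w) (nf_JFint hfc hfval hJ hJnorm v w)]
      have hi : Integrable (u - v : Lp ℝ 2 (volume : Measure (AddCircle (2 * τ)))) volume :=
        (Lp.memLp (u - v)).integrable (by norm_num)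
      calc ‖∫ z, (J (w - z) * f (u z) - J (w - z) * f (v z))‖
          ≤ ∫ z, Jnorm * k₁ * |(u - v : Lp ℝ 2 (volume : Measure (AddCircle (2 * τ)))) z| := by
            refine norm_integral_le_of_norm_le (hi.abs.const_mul _) ?_
            filter_upwards [Lp.coeFn_sub u v] with z hz
            rw [hz, Pi.sub_apply, ← mul_sub, norm_mul, mul_assoc]
            exact mul_le_mul (hJnorm _) (hflip _ _) (norm_nonneg _) hJ0
        _ = Jnorm * k₁ * ∫ z, |(u - v : Lp ℝ 2 (volume : Measure (AddCircle (2 * τ)))) z| :=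
            integral_const_mul _ _
        _ ≤ _ := by
            gcongr
            exact nf_L1 _
    have := Lp.norm_le_of_ae_bound (by positivity) hb
    rw [← NNReal.coe_rpow, nf_mass'] at this
    refine this.trans (le_of_eq ?_)
    ring
  have hR : ∀ u, ‖Φ u‖ ≤ (2 * τ * Jnorm * Smax + h) * Real.sqrt (2 * τ) := by
    intro u
    have := Lp.norm_le_of_ae_bound (f := Φ u) (C := 2 * τ * Jnorm * Smax + h) (by positivity) (by
      filter_upwards [hΦ u] with w hw
      rw [hw]
      exact nf_bound hfval hJnorm h hh u w)
    rw [← NNReal.coe_rpow, nf_mass'] at this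
    exact this.trans (le_of_eq (mul_comm _ _))
  -- compactness
  have hgc : ∀ u : Lp ℝ 2 (volume : Measure (AddCircle (2 * τ))),
      Continuous fun w => (∫ z, J (w - z) * f (u z)) + h := by
    intro u
    refine Metric.continuous_iff.2 fun b ε hε => ?_
    obtain ⟨δ, hδ, hd⟩ := nf_cont hfc hfval hJ hJnorm hSmax h ε hε
    exact ⟨δ, hδ, fun a ha => hd u a b ha⟩
  let G : Lp ℝ 2 (volume : Measure (AddCircle (2 * τ))) →
      BoundedContinuousFunction (AddCircle (2 * τ)) ℝ :=
    fun u => BoundedContinuousFunction.mkOfCompact ⟨_, hgc u⟩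
  have hG : ∀ u w, G u w = (∫ z, J (w - z) * f (u z)) + h := fun u w => rfl
  have hcomp : IsCompact (closure (Set.range G)) := by
    refine BoundedContinuousFunction.arzela_ascoli
      (Metric.closedBall 0 (2 * τ * Jnorm * Smax + h)) (isCompact_closedBall _ _) _ ?_ ?_
    · rintro _ w ⟨u, rfl⟩
      rw [mem_closedBall_zero_iff, hG]
      exact nf_bound hfval hJnorm h hh u w
    · intro x
      rw [Metric.equicontinuousAt_iff]
      intro ε hε
      obtain ⟨δ, hδ, hd⟩ := nf_cont hfc hfval hJ hJnorm hSmax h ε hε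
      refine ⟨δ, hδ, ?_⟩
      rintro y hy ⟨_, u, rfl⟩
      exact hd u x y (by rwa [dist_comm])
  refine nf_abstract hLip hT
    (BoundedContinuousFunction.toLp (E := ℝ) 2 volume ℝ '' closure (Set.range G))
    (hcomp.image (ContinuousLinearMap.continuous _)) ?_ _ hR
  intro u
  refine ⟨G u, subset_closure ⟨u, rfl⟩, ?_⟩
  apply Lp.ext
  refine (BoundedContinuousFunction.coeFn_toLp 2 volume ℝ (G u)).trans ?_
  exact (hΦ u).symm
end
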